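/- Let (X, μ) be a probability space, f : X → ℝ integrable, and F : ℝ → ℝ convex and differentiable with F ∘ f integrable. Let P and P' be finite measurable partitions of X whose cells all have positive measure, such that P' refines P (every cell of P' is contained in some cell of P). Then ∫ D_F(f‖h_{P'}) dμ ≤ ∫ D_F(f‖h_P) dμ: refining the partition never increases the integrated Bregman approximation error of the conditional-mean simplification. -/

import Mathlib

open MeasureTheory

/-- A differentiable convex function on `ℝ` lies above its tangent lines. -/
theorem ConvexOn.add_mul_le_of_hasDerivAt {F : ℝ → ℝ} {d b : ℝ} (hF : ConvexOn ℝ Set.univ F)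
    (hd : HasDerivAt F d b) (a : ℝ) : F b + (a - b) * d ≤ F a := by
  rcases lt_trichotomy a b with hab | rfl | hab
  · have hs := hF.slope_le_of_hasDerivAt (Set.mem_univ a) (Set.mem_univ b) hab hd
    rw [slope_def_field, div_le_iff₀ (sub_pos.2 hab)] at hs
    linarith
  · simp
  · have hs := hF.le_slope_of_hasDerivAt (Set.mem_univ b) (Set.mem_univ a) hab hd
    rw [slope_def_field, le_div_iff₀ (sub_pos.2 hab)] at hs
    linarith

/-- The pointwise Bregman divergence from `f` to a constant is integrable. -/
theorem integrable_bregman_const {X : Type*} [MeasurableSpace X] {μ : Measure X}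
    [IsFiniteMeasure μ] {f : X → ℝ} (hf : Integrable f μ) {F : ℝ → ℝ}
    (hFf : Integrable (F ∘ f) μ) (b d : ℝ) :
    Integrable (fun x => F (f x) - F b - (f x - b) * d) μ :=
  (hFf.sub (integrable_const _)).sub ((hf.sub (integrable_const b)).mul_const d)

theorem integral_bregman_const {X : Type*} [MeasurableSpace X] {μ : Measure X}
    [IsFiniteMeasure μ] {f : X → ℝ} (hf : Integrable f μ) {F : ℝ → ℝ}
    (hFf : Integrable (F ∘ f) μ) (b d : ℝ) :
    ∫ x, (F (f x) - F b - (f x - b) * d) ∂μ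
      = (∫ x, F (f x) ∂μ) - μ.real Set.univ * F b
        - ((∫ x, f x ∂μ) - μ.real Set.univ * b) * d := by
  have hFf' : Integrable (fun x => F (f x)) μ := hFf
  have hFb : Integrable (fun x => F (f x) - F b) μ := hFf'.sub (integrable_const _)
  have hfb : Integrable (fun x => f x - b) μ := hf.sub (integrable_const _)
  rw [integral_sub hFb (hfb.mul_const d),
    integral_sub hFf' (integrable_const _), integral_mul_const,
    integral_sub hf (integrable_const _)]
  simp

/-- Among all constants, the mean of `f` minimizes the integrated Bregman divergence from `f`. -/
theorem integral_bregman_mean_le {X : Type*} [MeasurableSpace X] {μ : Measure X}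
    [IsFiniteMeasure μ] {f : X → ℝ} (hf : Integrable f μ) {F F' : ℝ → ℝ}
    (hF : ConvexOn ℝ Set.univ F) (hF' : ∀ x, HasDerivAt F (F' x) x)
    (hFf : Integrable (F ∘ f) μ) {m : ℝ} (hm : ∫ x, f x ∂μ = μ.real Set.univ * m) (b : ℝ) :
    ∫ x, (F (f x) - F m - (f x - m) * F' m) ∂μ
      ≤ ∫ x, (F (f x) - F b - (f x - b) * F' b) ∂μ := by
  rw [integral_bregman_const hf hFf, integral_bregman_const hf hFf, hm]
  have := mul_le_mul_of_nonneg_left (hF.add_mul_le_of_hasDerivAt (hF' b) m)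
    (measureReal_nonneg (μ := μ) (s := Set.univ))
  linarith

/-- A function that is piecewise constant on disjoint sets takes the prescribed value on each. -/
theorem sum_indicator_const_eq_of_mem {X I M : Type*} [Fintype I] [AddCommMonoid M]
    {C : I → Set X} (hdisj : Pairwise (Function.onFun Disjoint C)) (c : I → M) {i : I} {x : X}
    (hx : x ∈ C i) : ∑ j, Set.indicator (C j) (fun _ => c j) x = c i := by
  rw [Finset.sum_eq_single i, Set.indicator_of_mem hx]
  · exact fun j _ hji => Set.indicator_of_notMem
      (fun hj => Set.disjoint_left.1 (hdisj hji) hj hx) _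
  · simp

/-- refining the partition never increases the integrated Bregman
approximation error of the conditional-mean simplification. -/
theorem integral_bregman_refinement_le
    {X : Type*} [MeasurableSpace X] (μ : Measure X) [IsProbabilityMeasure μ]
    (f : X → ℝ) (hf : Integrable f μ)
    (F F' : ℝ → ℝ) (hF : ConvexOn ℝ Set.univ F)
    (hF' : ∀ x, HasDerivAt F (F' x) x)
    (hFf : Integrable (F ∘ f) μ)
    -- partition P
    {I : Type*} [Fintype I] (C : I → Set X)
    (hmeas : ∀ i, MeasurableSet (C i))
    (hpos : ∀ i, 0 < μ (C i))
    (hdisj : Pairwise (Function.onFun Disjoint C))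
    (hcover : (⋃ i, C i) = Set.univ)
    (c : I → ℝ) (hc : ∀ i, c i = (∫ x in C i, f x ∂μ) / (μ (C i)).toReal)
    (h : X → ℝ) (hh : ∀ x, h x = ∑ i, Set.indicator (C i) (fun _ => c i) x)
    -- partition P', refining P
    {I' : Type*} [Fintype I'] (C' : I' → Set X)
    (hmeas' : ∀ i, MeasurableSet (C' i))
    (hpos' : ∀ i, 0 < μ (C' i))
    (hdisj' : Pairwise (Function.onFun Disjoint C'))
    (hcover' : (⋃ i, C' i) = Set.univ)
    (hrefine : ∀ i', ∃ i, C' i' ⊆ C i)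
    (c' : I' → ℝ) (hc' : ∀ i, c' i = (∫ x in C' i, f x ∂μ) / (μ (C' i)).toReal)
    (h' : X → ℝ) (hh' : ∀ x, h' x = ∑ i, Set.indicator (C' i) (fun _ => c' i) x) :
    (∫ x, (F (f x) - F (h' x) - (f x - h' x) * F' (h' x)) ∂μ)
      ≤ ∫ x, (F (f x) - F (h x) - (f x - h x) * F' (h x)) ∂μ := by
  choose r hr using hrefine
  have hval' : ∀ j, ∀ x ∈ C' j, h' x = c' j := fun j x hx => by
    rw [hh', sum_indicator_const_eq_of_mem hdisj' c' hx]
  have hval : ∀ j, ∀ x ∈ C' j, h x = c (r j) := fun j x hx => by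
    rw [hh, sum_indicator_const_eq_of_mem hdisj c (hr j hx)]
  have hsplit : ∀ (g : X → ℝ) (b : I' → ℝ), (∀ j, ∀ x ∈ C' j, g x = b j) →
      ∫ x, (F (f x) - F (g x) - (f x - g x) * F' (g x)) ∂μ
        = ∑ j, ∫ x in C' j, (F (f x) - F (b j) - (f x - b j) * F' (b j)) ∂μ := by
    intro g b hg
    have hcell : ∀ j, Set.EqOn (fun x => F (f x) - F (b j) - (f x - b j) * F' (b j))
        (fun x => F (f x) - F (g x) - (f x - g x) * F' (g x)) (C' j) := fun j x hx => by
      simp only [hg j x hx]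
    rw [← setIntegral_univ, ← hcover', integral_iUnion_fintype hmeas' hdisj' fun j =>
      (integrable_bregman_const hf hFf (b j) (F' (b j))).integrableOn.congr_fun
        (hcell j) (hmeas' j)]
    exact Finset.sum_congr rfl fun j _ => (setIntegral_congr_fun (hmeas' j) (hcell j)).symm
  rw [hsplit h' c' hval', hsplit h (fun j => c (r j)) hval]
  refine Finset.sum_le_sum fun j _ =>
    integral_bregman_mean_le hf.restrict hF hF' hFf.restrict ?_ _
  have hne : (μ (C' j)).toReal ≠ 0 :=
    (ENNReal.toReal_pos (hpos' j).ne' (measure_ne_top _ _)).ne'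
  rw [hc', measureReal_restrict_apply_univ, measureReal_def, mul_div_cancel₀ _ hne]
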